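/- Let p and r be distinct primes with p dividing r − 1, let V be a nontrivial finite elementary abelian r-group (i.e. every non-identity element of V has order r and V is abelian), and let c be an automorphism of V of order p. Then there exists a nontrivial cyclic subgroup of V that is invariant under c. -/

import Mathlib

open Subgroup

/-- An endomorphism of a nontrivial finite-dimensional space over a finite field `K` satisfying
`f ^ (#K) = f` has an eigenvalue in `K`. -/
theorem Module.End.exists_hasEigenvalue_of_pow_card_eq_self {K M : Type*} [Field K] [Fintype K]
    [AddCommGroup M] [Module K M] [FiniteDimensional K M] [Nontrivial M] (f : Module.End K M)
    (hf : f ^ Fintype.card K = f) : ∃ a, f.HasEigenvalue a := by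
  have hK : 1 < Fintype.card K := Fintype.one_lt_card
  have hne : (Polynomial.X ^ Fintype.card K - Polynomial.X : Polynomial K) ≠ 0 :=
    FiniteField.X_pow_card_sub_X_ne_zero K hK
  have hsplit : (Polynomial.X ^ Fintype.card K - Polynomial.X : Polynomial K).Splits := by
    rw [Polynomial.splits_iff_card_roots, FiniteField.roots_X_pow_card_sub_X,
      FiniteField.X_pow_card_sub_X_natDegree_eq K hK]
    rfl
  have hdvd : minpoly K f ∣ Polynomial.X ^ Fintype.card K - Polynomial.X :=
    minpoly.dvd K f (by simp [hf])
  obtain ⟨a, ha⟩ := (hsplit.of_dvd hne hdvd).exists_eval_eq_zero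
    (minpoly.degree_pos (Algebra.IsIntegral.isIntegral f)).ne'
  exact ⟨a, Module.End.hasEigenvalue_of_isRoot ha⟩

/-- An automorphism of a nontrivial finite elementary abelian `r`-group whose `r`-th power is itself
maps some non-identity element to one of its powers. -/
theorem MulAut.exists_apply_eq_pow_of_pow_eq_self {V : Type*} [CommGroup V] [Finite V]
    [Nontrivial V] {r : ℕ} [Fact r.Prime] (hV : ∀ v : V, v ^ r = 1) (c : MulAut V)
    (hc : c ^ r = c) : ∃ v : V, v ≠ 1 ∧ ∃ n : ℕ, c v = v ^ n := by
  let _ : Module (ZMod r) (Additive V) := AddCommGroup.zmodModule (n := r) fun x => hV x.toMul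
  let f : Module.End (ZMod r) (Additive V) :=
    (MonoidHom.toAdditive c.toMonoidHom).toZModLinearMap r
  have hfc (n : ℕ) (x : V) : (f ^ n) (Additive.ofMul x) = Additive.ofMul ((c ^ n) x) := by
    induction n with
    | zero => rfl
    | succ n ih => rw [pow_succ', pow_succ', Module.End.mul_apply, ih]; rfl
  have hf : f ^ Fintype.card (ZMod r) = f := by
    rw [ZMod.card]
    ext x
    have := hfc r x.toMul
    rw [hc] at this
    exact this
  obtain ⟨a, ha⟩ := f.exists_hasEigenvalue_of_pow_card_eq_self hf
  obtain ⟨v, hv⟩ := ha.exists_hasEigenvector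
  refine ⟨v.toMul, hv.2, a.val, ?_⟩
  have h : f v = a.val • v := by
    rw [hv.apply_eq_smul, ← Nat.cast_smul_eq_nsmul (ZMod r), ZMod.natCast_zmod_val]
  exact h

theorem exists_invariant_cyclic_subgroup
    (p r : ℕ) (hp : p.Prime) (hr : r.Prime) (hpr : p ≠ r) (hdvd : p ∣ (r - 1))
    (V : Type*) [CommGroup V] [Finite V] [Nontrivial V]
    (helem : ∀ v : V, v ≠ 1 → orderOf v = r)
    (c : MulAut V) (hc : orderOf c = p) :
    ∃ W : Subgroup V, W ≠ ⊥ ∧ IsCyclic W ∧ W.map c.toMonoidHom = W := by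
  have : Fact r.Prime := ⟨hr⟩
  have hV (v : V) : v ^ r = 1 := by
    rcases eq_or_ne v 1 with rfl | hv
    · exact one_pow r
    · exact orderOf_dvd_iff_pow_eq_one.mp (helem v hv).dvd
  have hcr : c ^ r = c := by
    rw [← Nat.sub_add_cancel hr.one_le, pow_succ, orderOf_dvd_iff_pow_eq_one.mp (hc ▸ hdvd),
      one_mul]
  obtain ⟨v, hv, n, hn⟩ := MulAut.exists_apply_eq_pow_of_pow_eq_self hV c hcr
  refine ⟨zpowers v, zpowers_ne_bot.mpr hv, inferInstance, ?_⟩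
  refine eq_of_le_of_card_ge ?_ (card_map_of_injective c.injective).ge
  rw [MonoidHom.map_zpowers, zpowers_le]
  exact hn ▸ npow_mem_zpowers v n
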